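/- arXiv:2209.06891 — 2 statements merged into one kernel-verified Lean document; each statement's English description precedes it below -/
import Mathlib

section
/- For every finite word w over a (possibly arbitrary finite) alphabet, m(w) ≤ |w| − |Alph(w)|, where m(w) denotes the number of distinct nonempty factors of w that are powers of exponent at least 2. -/
/-- `numPowers w` is the number of distinct nonempty factors of `w` that are
powers of exponent at least 2, i.e. of the form `u^j` with `u` nonempty and `j ≥ 2`. -/
noncomputable def numPowers {α : Type*} (w : List α) : ℕ :=
  Set.ncard {v : List α | v <:+: w ∧
    ∃ u : List α, u ≠ [] ∧ ∃ j : ℕ, 2 ≤ j ∧ v = (List.replicate j u).flatten}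

/-- `numSquares w` is the number of distinct squares occurring as factors of `w`. -/
noncomputable def numSquares {α : Type*} (w : List α) : ℕ :=
  Set.ncard {v : List α | v <:+: w ∧ ∃ u : List α, u ≠ [] ∧ v = u ++ u}

/-- The binary word `a^{r 0} b a^{r 1} b ⋯ a^{r (k-1)} b a^{r k}` over the
alphabet `Bool`, where `a := false` and `b := true`. -/
def binWord (k : ℕ) (r : Fin (k + 1) → ℕ) : List Bool :=
  (List.ofFn (fun j : Fin k => List.replicate (r j.castSucc) false ++ [true])).flatten
    ++ List.replicate (r (Fin.last k)) false

/-- The factor of length `n` of the infinite word `g` starting at position `i`. -/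
def window {α : Type*} (g : ℕ → α) (i n : ℕ) : List α := (List.range' i n).map g

section Window

variable {α : Type*}

@[simp] lemma length_window (g : ℕ → α) (i n : ℕ) : (window g i n).length = n := by
  simp [window]

lemma tail_window (g : ℕ → α) (i n : ℕ) : (window g i (n + 1)).tail = window g (i + 1) n := by
  simp [window, List.range'_succ]

lemma dropLast_window (g : ℕ → α) (i n : ℕ) :
    (window g i (n + 1)).dropLast = window g i n := by
  simp [window, List.range'_concat]

lemma window_add (g : ℕ → α) (i m n : ℕ) :
    window g i (m + n) = window g i m ++ window g (i + m) n := by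
  simp [window, ← List.map_append]

lemma window_isInfix (g : ℕ → α) {i n d m : ℕ} (h : d + m ≤ n) :
    window g (i + d) m <:+: window g i n := by
  obtain ⟨k, rfl⟩ := Nat.exists_eq_add_of_le h
  exact ⟨window g i d, window g (i + (d + m)) k, by rw [window_add, window_add]⟩

lemma window_eq_iff {g h : ℕ → α} {i j n : ℕ} :
    window g i n = window h j n ↔ ∀ k < n, g (i + k) = h (j + k) := by
  constructor
  · intro e k hk
    have := congrArg (fun l => l[k]?) e
    simpa [window, hk] using this
  · intro e
    apply List.ext_getElem (by simp)
    intro k h1 h2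
    simpa [window] using e k (by simpa using h1)

lemma window_add_period {g : ℕ → α} {p : ℕ} (hp : Function.Periodic g p) (i n : ℕ) :
    window g (i + p) n = window g i n :=
  window_eq_iff.2 fun k _ => by rw [add_right_comm, hp]

lemma window_mod_period {g : ℕ → α} {p : ℕ} (hp : Function.Periodic g p) (i n : ℕ) :
    window g (i % p) n = window g i n :=
  Function.Periodic.map_mod_nat (f := fun i => window g i n)
    (fun i => window_add_period hp i n) i

lemma window_mul_period {g : ℕ → α} {p : ℕ} (hp : Function.Periodic g p) (j : ℕ) :
    window g 0 (j * p) = (List.replicate j (window g 0 p)).flatten := by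
  induction j with
  | zero => simp [window]
  | succ j ih =>
    rw [List.replicate_succ, List.flatten_cons, ← ih, add_mul, one_mul, add_comm, window_add,
      window_add_period hp]

end Window

section Lyndon

variable {α : Type*} [LinearOrder α]

/-- `h` is a periodic infinite word whose period `p` is the length of a Lyndon word: all the
other rotations of `h` are lexicographically larger. -/
structure IsLyndonPeriodic (h : ℕ → α) (p : ℕ) : Prop where
  pos : 0 < p
  periodic : Function.Periodic h p
  lt_rotate : ∀ i, 0 < i → i < p → toLex h < toLex (fun k => h (k + i))

lemma IsLyndonPeriodic.unbordered {h : ℕ → α} {p q : ℕ} (H : IsLyndonPeriodic h p)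
    (hq : 0 < q) (hqp : q < p) : ¬ ∀ i, i + q < p → h i = h (i + q) := by
  intro hb
  obtain ⟨i, hi, hlt⟩ := H.lt_rotate q hq hqp
  change ∀ j < i, h j = h (j + q) at hi
  change h i < h (i + q) at hlt
  have him : p - q ≤ i := by
    by_contra! hc
    exact hlt.ne (hb i (by omega))
  obtain ⟨d, rfl⟩ := Nat.exists_eq_add_of_le' him
  refine lt_asymm (H.lt_rotate (p - q) (by omega) (by omega)) ⟨d, fun j hj => ?_, ?_⟩
  · change h (j + (p - q)) = h j
    change j < d at hj
    have := hi (j + (p - q)) (by omega)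
    rw [show j + (p - q) + q = j + p by omega, H.periodic] at this
    exact this
  · change h (d + (p - q)) < h d
    rw [show d + (p - q) + q = d + p by omega, H.periodic] at hlt
    exact hlt

lemma IsLyndonPeriodic.le_of_window_eq {h g : ℕ → α} {p q i m : ℕ} (H : IsLyndonPeriodic h q)
    (hp : 0 < p) (hg : Function.Periodic g p) (hm : q ≤ m)
    (e : window h 0 m = window g i m) : q ≤ p := by
  by_contra! hc
  rw [window_eq_iff] at e
  simp only [zero_add] at e
  refine H.unbordered hp hc fun k hk => ?_
  rw [e k (by omega), e (k + p) (by omega), ← add_assoc, hg]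

omit [LinearOrder α] in
lemma periodic_eq_of_eqOn_lt {h g : ℕ → α} {p : ℕ} (hp : 0 < p)
    (hh : Function.Periodic h p) (hg : Function.Periodic g p) (e : ∀ k < p, h k = g k) :
    h = g := by
  funext k
  rw [← hh.map_mod_nat, ← hg.map_mod_nat, e _ (Nat.mod_lt _ hp)]

lemma IsLyndonPeriodic.eq_of_window_eq {h g : ℕ → α} {p q m : ℕ} (H : IsLyndonPeriodic h q)
    (G : IsLyndonPeriodic g p) (hq : q ≤ m) (hp : p ≤ m)
    (e : window h 0 m = window g 0 m) : h = g ∧ q = p := by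
  have hqp : q = p := le_antisymm (H.le_of_window_eq G.pos G.periodic hq e)
    (G.le_of_window_eq H.pos H.periodic hp e.symm)
  subst hqp
  refine ⟨periodic_eq_of_eqOn_lt H.pos H.periodic G.periodic fun k hk => ?_, rfl⟩
  simpa using window_eq_iff.1 e k (by omega)

lemma IsLyndonPeriodic.lt_of_window_eq {h g : ℕ → α} {p q i m : ℕ} (H : IsLyndonPeriodic h q)
    (G : IsLyndonPeriodic g p) (hq : q ≤ m) (hi : 0 < i) (hip : i < p)
    (e : window h 0 m = window g i m) : q < p := by
  refine lt_of_le_of_ne (H.le_of_window_eq G.pos G.periodic hq e) ?_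
  rintro rfl
  have hrot : h = fun k => g (k + i) := by
    refine periodic_eq_of_eqOn_lt H.pos H.periodic
      (fun k => by rw [add_right_comm, G.periodic]) fun k hk => ?_
    simpa [add_comm] using window_eq_iff.1 e k (by omega)
  have hrot' : g = fun k => h (k + (q - i)) := by
    funext k
    rw [hrot]
    simp only
    rw [add_assoc, Nat.sub_add_cancel hip.le, G.periodic]
  have h1 := G.lt_rotate i hi hip
  have h2 := H.lt_rotate (q - i) (by omega) (by omega)
  rw [← hrot] at h1
  rw [← hrot'] at h2
  exact lt_asymm h1 h2

lemma exists_isLyndonPeriodic {g : ℕ → α} {N : ℕ} (hN : 0 < N) (hg : Function.Periodic g N) :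
    ∃ h p s, IsLyndonPeriodic h p ∧ p ∣ N ∧ s < p ∧ ∀ n, window g 0 n = window h s n := by
  classical
  have hex : ∃ p, 0 < p ∧ Function.Periodic g p := ⟨N, hN, hg⟩
  obtain ⟨p, ⟨hp, hgp⟩, hmin⟩ : ∃ p, (0 < p ∧ Function.Periodic g p) ∧
      ∀ q, 0 < q → q < p → ¬ Function.Periodic g q :=
    ⟨Nat.find hex, Nat.find_spec hex, fun q h0 hq hc => Nat.find_min hex hq ⟨h0, hc⟩⟩
  obtain ⟨i, hi, hle⟩ := Finset.exists_min_image (Finset.range p)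
    (fun i => toLex (fun k => g (k + i))) ⟨0, by simpa using hp⟩
  have hip : i < p := by simpa using hi
  have hle' : ∀ j, toLex (fun k => g (k + i)) ≤ toLex (fun k => g (k + j)) := by
    intro j
    convert hle (j % p) (by simpa using Nat.mod_lt _ hp) using 2
    funext k
    rw [← hgp.map_mod_nat (k + j), ← hgp.map_mod_nat (k + j % p), Nat.add_mod_mod]
  have hper : Function.Periodic (fun k => g (k + i)) p := fun k => by
    change g (k + p + i) = g (k + i)
    rw [add_right_comm, hgp]
  refine ⟨fun k => g (k + i), p, (p - i) % p, ⟨hp, hper, ?_⟩, ?_, Nat.mod_lt _ hp, ?_⟩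
  · intro j hj hjp
    have h1 := hle' (j + i)
    simp only [← add_assoc] at h1
    refine lt_of_le_of_ne h1 fun he => hmin j hj hjp fun k => ?_
    have := congrFun (toLex.injective he) (k + (p - i))
    rw [show k + (p - i) + i = k + p by omega,
      show k + (p - i) + j + i = k + j + p by omega, hgp, hgp] at this
    exact this.symm
  · by_contra hc
    have hpos : 0 < N % p := Nat.pos_of_ne_zero fun h0 => hc (Nat.dvd_of_mod_eq_zero h0)
    refine hmin _ hpos (Nat.mod_lt _ hp) fun k => ?_
    rw [← hgp.map_mod_nat, Nat.add_mod_mod, hgp.map_mod_nat, hg]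
  · intro n
    rw [window_mod_period hper, window_eq_iff]
    intro k _
    rw [show p - i + k + i = k + p by omega, hgp, zero_add]

end Lyndon

section Counting

/-- If the values at the vertices in `F` of every function are determined, up to a constant, by
its differences along the edges in `E`, then there are at most `#E + 1` vertices. -/
lemma Finset.card_le_card_add_one_of_connected {X Y : Type*} (F : Finset X) (E : Finset Y)
    (s t : Y → X) (v : X)
    (H : ∀ f : X → ℚ, (∀ e ∈ E, f (s e) = f (t e)) → ∀ x ∈ F, f x = f v) :
    F.card ≤ E.card + 1 := by
  let ext : (F → ℚ) →ₗ[ℚ] (X → ℚ) := Function.ExtendByZero.linearMap ℚ Subtype.val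
  let d : (X → ℚ) →ₗ[ℚ] (E → ℚ) × ℚ :=
    (LinearMap.pi fun e : E => (LinearMap.proj (s e) : (X → ℚ) →ₗ[ℚ] ℚ) -
      LinearMap.proj (t e)).prod (LinearMap.proj v)
  have hinj : Function.Injective (d ∘ₗ ext) := by
    rw [← LinearMap.ker_eq_bot, LinearMap.ker_eq_bot']
    intro f hf
    have h1 : ∀ e ∈ E, ext f (s e) = ext f (t e) := fun e he =>
      sub_eq_zero.1 (congrFun (congrArg Prod.fst hf) ⟨e, he⟩)
    have h2 : ext f v = 0 := congrArg Prod.snd hf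
    funext x
    have h3 := H (ext f) h1 x x.2
    rw [h2] at h3
    rw [← Subtype.val_injective.extend_apply f 0 x]
    exact h3
  simpa using LinearMap.finrank_le_finrank_of_injective hinj

variable {α : Type*}

lemma finite_factors (w : List α) : {v : List α | v <:+: w}.Finite := by
  refine (List.finite_toSet w.sublists).subset fun v hv => ?_
  simpa using List.IsInfix.sublist hv

/-- The factors of `w` of length `n`. -/
def factorsOfLength (w : List α) (n : ℕ) : Set (List α) := {v | v <:+: w ∧ v.length = n}

lemma finite_factorsOfLength (w : List α) (n : ℕ) : (factorsOfLength w n).Finite :=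
  (finite_factors w).subset fun _ h => h.1

lemma exists_eq_take_drop_of_isInfix {v w : List α} (h : v <:+: w) :
    ∃ i, i + v.length ≤ w.length ∧ v = (w.drop i).take v.length := by
  obtain ⟨s, t, rfl⟩ := h
  exact ⟨s.length, by simp, by simp⟩

lemma apply_eq_of_forall_factors {β : Type*} (w : List α) (n : ℕ) (f : List α → β)
    (H : ∀ e ∈ factorsOfLength w (n + 1), f e.dropLast = f e.tail) :
    ∀ x ∈ factorsOfLength w n, f x = f (w.take n) := by
  have key : ∀ i, i + n ≤ w.length → f ((w.drop i).take n) = f (w.take n) := by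
    intro i
    induction i with
    | zero => simp
    | succ i ih =>
      intro hi
      rw [← ih (by omega)]
      have he : (w.drop i).take (n + 1) ∈ factorsOfLength w (n + 1) :=
        ⟨(List.take_prefix _ _).isInfix.trans (List.drop_suffix _ _).isInfix, by
          simp only [List.length_take, List.length_drop]; omega⟩
      have hl : (w.drop i).length ≠ 0 := by simp only [List.length_drop]; omega
      obtain ⟨a, l, hal⟩ := List.exists_cons_of_length_pos (Nat.pos_of_ne_zero hl)
      have hl' : l = w.drop (i + 1) := by rw [← List.tail_drop, hal, List.tail_cons]
      have hn : n ≤ l.length := by rw [hl', List.length_drop]; omega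
      have := H _ he
      rw [List.dropLast_eq_take, List.length_take_of_le (by rw [hal]; simpa using hn),
        List.take_take, Nat.add_sub_cancel, min_eq_left (Nat.le_succ n)] at this
      rw [this, hal, List.take_succ_cons, List.tail_cons, hl']
  rintro x ⟨hx, rfl⟩
  obtain ⟨i, hi, e⟩ := exists_eq_take_drop_of_isInfix hx
  conv_lhs => rw [e]
  exact key i hi

lemma ncard_factorsOfLength_one [DecidableEq α] (w : List α) :
    (factorsOfLength w 1).ncard = w.toFinset.card := by
  have : factorsOfLength w 1 = (fun a => [a]) '' (w.toFinset : Set α) := by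
    ext v
    simp only [factorsOfLength, Set.mem_ofPred_eq, Set.mem_image, List.coe_toFinset,
      List.length_eq_one_iff]
    constructor
    · rintro ⟨h, a, rfl⟩
      exact ⟨a, h.subset (by simp), rfl⟩
    · rintro ⟨a, ha, rfl⟩
      obtain ⟨s, t, rfl⟩ := List.append_of_mem ha
      exact ⟨⟨s, t, by simp⟩, a, rfl⟩
  rw [this, Set.ncard_image_of_injective _ (fun a b h => by simpa using h),
    Set.ncard_coe_finset]

lemma ncard_factorsOfLength_length (w : List α) :
    (factorsOfLength w w.length).ncard = 1 := by
  rw [Set.ncard_eq_one]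
  refine ⟨w, Set.ext fun v => ⟨fun h => h.1.eq_of_length h.2, ?_⟩⟩
  rintro rfl
  exact ⟨List.infix_rfl, rfl⟩

variable [LinearOrder α]

/-- The distinguished edges of the Rauzy graphs of `w`: one for each circuit whose length is at
most the order of the graph, namely the edge labelled by a prefix of a power of a Lyndon word. -/
def lyndonEdges (w : List α) : Set (List α) :=
  {x | ∃ h p, IsLyndonPeriodic h p ∧ p < x.length ∧ x = window h 0 x.length ∧
    ∀ t, window h t x.length <:+: w}

lemma isInfix_of_mem_lyndonEdges {w x : List α} (hx : x ∈ lyndonEdges w) : x <:+: w := by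
  obtain ⟨h, p, -, -, e, H⟩ := hx
  rw [e]
  exact H 0

/-- Removing the distinguished edges does not disconnect the Rauzy graph of order `n`. -/
lemma apply_eq_of_mem_lyndonEdges {β : Type*} (w : List α) (n : ℕ) (f : List α → β)
    (H : ∀ e ∈ factorsOfLength w (n + 1) \ lyndonEdges w, f e.dropLast = f e.tail) :
    ∀ e ∈ factorsOfLength w (n + 1), f e.dropLast = f e.tail := by
  have key : ∀ p (h : ℕ → α), IsLyndonPeriodic h p → p ≤ n →
      (∀ t, window h t (n + 1) <:+: w) → f (window h 0 n) = f (window h 1 n) := by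
    intro p
    induction p using Nat.strong_induction_on with
    | _ p ih =>
      intro h hL hpn hw
      have step : ∀ i, 0 < i → i < p → f (window h i n) = f (window h (i + 1) n) := by
        intro i hi hip
        by_cases hmem : window h i (n + 1) ∈ lyndonEdges w
        · obtain ⟨g, q, hg, hq, e, hgw⟩ := hmem
          rw [length_window] at hq e hgw
          have hqp := hg.lt_of_window_eq hL hq.le hi hip e.symm
          have := ih q hqp g hg (by omega) hgw
          rwa [← dropLast_window, ← tail_window g 0, ← e, dropLast_window, tail_window] at this
        · have := H _ ⟨⟨hw i, length_window _ _ _⟩, hmem⟩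
          rwa [dropLast_window, tail_window] at this
      have chain : ∀ i, i < p → f (window h 1 n) = f (window h (i + 1) n) := by
        intro i
        induction i with
        | zero => intro _; rfl
        | succ i ih' => exact fun hi => (ih' (by omega)).trans (step _ (by omega) hi)
      have hp := hL.pos
      have := chain (p - 1) (by omega)
      rw [Nat.sub_add_cancel hp, ← zero_add p, window_add_period hL.periodic] at this
      exact this.symm
  intro e he
  by_cases hmem : e ∈ lyndonEdges w
  · obtain ⟨h, p, hL, hp, e1, hw⟩ := hmem
    rw [he.2] at hp e1 hw
    rw [e1, dropLast_window, tail_window]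
    exact key p h hL (by omega) hw
  · exact H e ⟨he, hmem⟩

lemma ncard_factorsOfLength_add_le (w : List α) (n : ℕ) :
    (factorsOfLength w n).ncard + (lyndonEdges w ∩ {x | x.length = n + 1}).ncard ≤
      (factorsOfLength w (n + 1)).ncard + 1 := by
  have hE := finite_factorsOfLength w (n + 1)
  have hF := finite_factorsOfLength w n
  have hD : (factorsOfLength w (n + 1) \ lyndonEdges w).Finite := hE.subset Set.sdiff_subset
  have h1 := Finset.card_le_card_add_one_of_connected hF.toFinset hD.toFinset
    List.dropLast List.tail (w.take n) (by
      intro f hf x hx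
      refine apply_eq_of_forall_factors w n f
        (apply_eq_of_mem_lyndonEdges w n f fun e he => hf e (by simpa using he)) x
        (by simpa using hx))
  rw [← Set.ncard_eq_toFinset_card _ hF, ← Set.ncard_eq_toFinset_card _ hD] at h1
  have h2 := Set.ncard_inter_add_ncard_sdiff_eq_ncard (factorsOfLength w (n + 1)) (lyndonEdges w)
    hE
  have h3 : lyndonEdges w ∩ {x | x.length = n + 1} =
      factorsOfLength w (n + 1) ∩ lyndonEdges w := by
    ext x
    exact ⟨fun h => ⟨⟨isInfix_of_mem_lyndonEdges h.1, h.2⟩, h.1⟩, fun h => ⟨h.2, h.1.2⟩⟩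
  rw [h3]
  omega

lemma finite_lyndonEdges (w : List α) : (lyndonEdges w).Finite :=
  (finite_factors w).subset fun _ => isInfix_of_mem_lyndonEdges

lemma ncard_lyndonEdges_le [DecidableEq α] (w : List α) :
    (lyndonEdges w).ncard ≤ w.length - w.toFinset.card := by
  have key : ∀ m, (factorsOfLength w 1).ncard +
      (lyndonEdges w ∩ {x | x.length ≤ m + 1}).ncard ≤
        (factorsOfLength w (m + 1)).ncard + m := by
    intro m
    induction m with
    | zero =>
      have : lyndonEdges w ∩ {x | x.length ≤ 0 + 1} = ∅ := by
        refine Set.eq_empty_of_forall_notMem ?_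
        rintro x ⟨⟨h, p, hL, hp, -⟩, hx⟩
        have := hL.pos
        simp only [Set.mem_ofPred_eq] at hx
        omega
      simp [this]
    | succ m ih =>
      have h1 := ncard_factorsOfLength_add_le w (m + 1)
      have h2 : lyndonEdges w ∩ {x | x.length ≤ m + 1 + 1} =
          (lyndonEdges w ∩ {x | x.length ≤ m + 1}) ∪
            (lyndonEdges w ∩ {x | x.length = m + 1 + 1}) := by
        rw [← Set.inter_union_distrib_left]
        congr 1
        ext x
        simp only [Set.mem_ofPred_eq, Set.mem_union]
        omega
      have h3 := Set.ncard_union_le (lyndonEdges w ∩ {x | x.length ≤ m + 1})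
        (lyndonEdges w ∩ {x | x.length = m + 1 + 1})
      rw [h2]
      omega
  have hlen : ∀ x ∈ lyndonEdges w, 0 < x.length ∧ x.length ≤ w.length := fun x hx =>
    ⟨by obtain ⟨h, p, -, hp, -⟩ := hx; omega, (isInfix_of_mem_lyndonEdges hx).length_le⟩
  rcases Nat.eq_zero_or_pos w.length with h0 | h0
  · have : lyndonEdges w = ∅ := Set.eq_empty_of_forall_notMem fun x hx => by
      have := hlen x hx
      omega
    simp [this]
  · have h1 := key (w.length - 1)
    have h2 : lyndonEdges w ∩ {x | x.length ≤ w.length} = lyndonEdges w :=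
      Set.inter_eq_left.2 fun x hx => (hlen x hx).2
    rw [Nat.sub_add_cancel h0, ncard_factorsOfLength_length, ncard_factorsOfLength_one, h2] at h1
    omega

omit [LinearOrder α] in
/-- If at least `i + 1` rotations of the Lyndon root of `h` have their `(j + 1)`-st power in `w`,
then `w` contains all factors of `h` of length `j * p + i + 1`. -/
lemma window_isInfix_of_lt_count {w : List α} {h : ℕ → α} {p j i : ℕ}
    (hper : Function.Periodic h p)
    [DecidablePred fun s => window h s ((j + 1) * p) <:+: w]
    (hi : i < Nat.count (fun s => window h s ((j + 1) * p) <:+: w) p) (t : ℕ) :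
    window h t (j * p + i + 1) <:+: w := by
  have hip : i < p := hi.trans_le (Nat.count_le _)
  have hQ : Function.Periodic (fun s => window h s ((j + 1) * p) <:+: w) p := fun s => by
    simp only [window_add_period hper]
  rw [← Nat.filter_Ico_card_eq_of_periodic (t + i + 1) p _ hQ] at hi
  obtain ⟨s, hs1, hs2, hs3⟩ : ∃ s, t + i + 1 ≤ s ∧ s ≤ t + p ∧
      window h s ((j + 1) * p) <:+: w := by
    by_contra! hc
    refine hi.not_ge ?_
    calc _ ≤ (Finset.Ico (t + p + 1) (t + p + 1 + i)).card := by
          refine Finset.card_le_card fun s hs => ?_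
          simp only [Finset.mem_filter, Finset.mem_Ico] at hs ⊢
          have : ¬ s ≤ t + p := fun h' => hc s hs.1.1 h' hs.2
          omega
      _ = i := by simp
  obtain ⟨d, hd⟩ := Nat.exists_eq_add_of_le hs2
  rw [← window_add_period hper, hd]
  refine (window_isInfix h ?_).trans hs3
  rw [add_mul]
  omega

/-- The powers of exponent at least `2` occurring in `w`. -/
def powerFactors {α : Type*} (w : List α) : Set (List α) :=
  {v | v <:+: w ∧ ∃ u : List α, u ≠ [] ∧ ∃ j : ℕ, 2 ≤ j ∧ v = (List.replicate j u).flatten}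

lemma exists_window_of_mem_powerFactors {w v : List α} (hv : v ∈ powerFactors w) :
    ∃ h p s j, IsLyndonPeriodic h p ∧ s < p ∧ 0 < j ∧ v = window h s ((j + 1) * p) := by
  obtain ⟨-, u, hu, k, hk, rfl⟩ := hv
  have hN : 0 < u.length := List.length_pos_iff.2 hu
  let g : ℕ → α := fun i => u[i % u.length]'(Nat.mod_lt _ hN)
  have hg : Function.Periodic g u.length := fun i => by simp [g]
  have hgu : window g 0 u.length = u := by
    refine List.ext_getElem (by simp) fun i h1 h2 => ?_
    simp [window, g, Nat.mod_eq_of_lt h2]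
  obtain ⟨h, p, s, hL, ⟨c, hc⟩, hs, e⟩ := exists_isLyndonPeriodic hN hg
  have hc0 : 0 < c := Nat.pos_of_ne_zero fun h0 => hN.ne' (by rw [hc, h0, mul_zero])
  have hkc : 2 ≤ k * c := hk.trans (Nat.le_mul_of_pos_right k hc0)
  refine ⟨h, p, s, k * c - 1, hL, hs, by omega, ?_⟩
  rw [Nat.sub_add_cancel (by omega), ← e]
  conv_lhs => rw [← hgu]
  rw [← window_mul_period hg, hc]
  congr 1
  ring

lemma ncard_powerFactors_le (w : List α) : (powerFactors w).ncard ≤ (lyndonEdges w).ncard := by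
  classical
  rcases (powerFactors w).eq_empty_or_nonempty with h0 | ⟨v₀, hv₀⟩
  · simp [h0]
  have : Nonempty (ℕ → α) := ⟨(exists_window_of_mem_powerFactors hv₀).choose⟩
  choose! h p s j hL hs hj hv using fun v (hv : v ∈ powerFactors w) =>
    exists_window_of_mem_powerFactors hv
  let rank : List α → ℕ := fun v =>
    Nat.count (fun t => window (h v) t ((j v + 1) * p v) <:+: w) (s v)
  have hmem : ∀ v ∈ powerFactors w, window (h v) (s v) ((j v + 1) * p v) <:+: w :=
    fun v hv' => by rw [← hv v hv']; exact hv'.1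
  have hle : ∀ v ∈ powerFactors w, p v ≤ j v * p v := fun v hv' =>
    Nat.le_mul_of_pos_left _ (hj v hv')
  have hrank : ∀ v ∈ powerFactors w, rank v < p v := fun v hv' =>
    (Nat.count_le _).trans_lt (hs v hv')
  refine Set.ncard_le_ncard_of_injOn (fun v => window (h v) 0 (j v * p v + rank v + 1))
    (fun v hv' => ?_) (fun v hv1 v' hv2 e => ?_) (finite_lyndonEdges w)
  · have hlt := hle v hv'
    refine ⟨h v, p v, hL v hv', ?_, ?_, ?_⟩ <;> simp only [length_window]
    · omega
    · refine window_isInfix_of_lt_count (hL v hv').periodic ?_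
      exact Nat.count_strict_mono (hmem v hv') (hs v hv')
  · have hlen : j v * p v + rank v + 1 = j v' * p v' + rank v' + 1 := by
      simpa using congrArg List.length e
    have l1 := hle v hv1
    have l2 := hle v' hv2
    have r1 := hrank v hv1
    have r2 := hrank v' hv2
    simp only [hlen] at e
    obtain ⟨eh, ep⟩ := (hL v hv1).eq_of_window_eq (hL v' hv2) (by omega) (by omega) e
    have hp := (hL v' hv2).pos
    rw [ep] at hlen r1
    have ej : j v = j v' := by
      have := congrArg (· / p v') (Nat.succ_injective hlen)
      simpa [mul_comm _ (p v'), Nat.mul_add_div hp, Nat.div_eq_of_lt r1,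
        Nat.div_eq_of_lt r2] using this
    have er : rank v = rank v' := by
      rw [ej] at hlen
      omega
    have es : s v = s v' := by
      have m1 := hmem v hv1
      simp only [rank, eh, ep, ej] at er m1
      exact Nat.count_injective m1 (hmem v' hv2) er
    rw [hv v hv1, hv v' hv2, eh, ep, ej, es]

end Counting

theorem power_count_bound {α : Type*} [DecidableEq α] (w : List α) :
    numPowers w ≤ w.length - w.toFinset.card := by
  obtain ⟨_, _⟩ := exists_wellFoundedLT α
  exact (ncard_powerFactors_le w).trans (ncard_lyndonEdges_le w)
end

section
/- For every finite word w, the number of distinct squares occurring as factors of w is at most the length of w: s(w) ≤ |w|. -/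
open Function

/-- The left shift on infinite words. -/
def shift {α : Type*} (x : ℕ → α) : ℕ → α := fun j => x (j + 1)

/-- The prefix of length `n` of an infinite word. -/
def pre {α : Type*} (x : ℕ → α) (n : ℕ) : List α := (List.range n).map x

/-- The factors of length `n` of a finite word. -/
def factors {α : Type*} (w : List α) (n : ℕ) : Set (List α) := {v | v <:+: w ∧ v.length = n}

/-- A periodic infinite word that is lexicographically minimal among its shifts. -/
def IsLyndon {α : Type*} [LinearOrder α] (x : ℕ → α) : Prop :=
  x ∈ periodicPts shift ∧ ∀ i, toLex x ≤ toLex (shift^[i] x)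

/-- The small circuits of the Rauzy graph of order `n` of `w`, represented by Lyndon words:
the vertices are the factors of length `n`, the edges those of length `n + 1`. -/
def circuits {α : Type*} [LinearOrder α] (w : List α) (n : ℕ) : Set (ℕ → α) :=
  {x | IsLyndon x ∧ minimalPeriod shift x ≤ n ∧ ∀ i, pre (shift^[i] x) (n + 1) <:+: w}

section Words

variable {α : Type*}

lemma shift_iterate_apply (x : ℕ → α) (i j : ℕ) : shift^[i] x j = x (j + i) := by
  induction i generalizing x with
  | zero => rfl
  | succ i ih => rw [iterate_succ_apply, ih, shift, Nat.add_assoc]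

@[simp] lemma length_pre (x : ℕ → α) (n : ℕ) : (pre x n).length = n := by simp [pre]

lemma pre_eq_iff {x y : ℕ → α} {n : ℕ} : pre x n = pre y n ↔ ∀ j < n, x j = y j := by
  simp [pre, List.map_inj_left]

lemma dropLast_pre (x : ℕ → α) (n : ℕ) : (pre x (n + 1)).dropLast = pre x n := by
  simp [pre, List.range_succ]

lemma tail_pre (x : ℕ → α) (n : ℕ) : (pre x (n + 1)).tail = pre (shift x) n := by
  simp [pre, List.range_succ_eq_map, shift, Function.comp_def]

lemma pre_iterate_shift_isInfix_pre (x : ℕ → α) {d k n : ℕ} (h : d + k ≤ n) :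
    pre (shift^[d] x) k <:+: pre x n := by
  have : pre (shift^[d] x) k = ((pre x n).drop d).take k := by
    apply List.ext_getElem
    · simp; omega
    · intro i h1 h2
      simp [pre, shift_iterate_apply, Nat.add_comm]
  rw [this]
  exact (List.take_prefix _ _).isInfix.trans (List.drop_suffix _ _).isInfix

lemma finite_factors_s4 (w : List α) (n : ℕ) : (factors w n).Finite := by
  refine (w.sublists.finite_toSet).subset fun v hv => ?_
  simpa using hv.1.sublist

lemma exists_drop_take_of_mem_factors {w v : List α} {n : ℕ} (h : v ∈ factors w n) :
    ∃ i, i + n ≤ w.length ∧ v = (w.drop i).take n := by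
  obtain ⟨⟨s, t, rfl⟩, rfl⟩ := h
  refine ⟨s.length, ?_, ?_⟩
  · simp
  · simp

lemma drop_take_mem_factors {w : List α} {i n : ℕ} (h : i + n ≤ w.length) :
    (w.drop i).take n ∈ factors w n := by
  refine ⟨(List.take_prefix _ _).isInfix.trans (List.drop_suffix _ _).isInfix, ?_⟩
  simp; omega

lemma apply_add_of_isPeriodicPt {x : ℕ → α} {q : ℕ} (h : IsPeriodicPt shift q x) (j : ℕ) :
    x (j + q) = x j := by
  rw [← shift_iterate_apply x, h.eq]

lemma apply_mod_of_isPeriodicPt {x : ℕ → α} {q : ℕ} (h : IsPeriodicPt shift q x) (j : ℕ) :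
    x (j % q) = x j := by
  have h1 := congrFun (h.const_mul (j / q)).eq (j % q)
  rw [shift_iterate_apply, Nat.mod_add_div'] at h1
  exact h1.symm

/-- If more than `r` conjugates of a square occur in `w`, then so do all the factors of length
`2 * h - l + r + 1` of the corresponding periodic word of period `l`. -/
lemma pre_infix_of_lt_card {w : List α} {x : ℕ → α} {h r : ℕ} {I : Finset ℕ}
    (hl : 0 < minimalPeriod shift x) (hlh : minimalPeriod shift x ≤ h)
    (hI : ∀ i ∈ I, i < minimalPeriod shift x ∧ pre (shift^[i] x) (2 * h) <:+: w)
    (hr : r < I.card) (j : ℕ) :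
    pre (shift^[j] x) (2 * h - minimalPeriod shift x + r + 1) <:+: w := by
  set l := minimalPeriod shift x with hldef
  have hIl : I ⊆ Finset.range l := fun i hi => Finset.mem_range.2 (hI i hi).1
  have hcard : I.card ≤ l := by simpa using Finset.card_le_card hIl
  let g : ℕ → ℕ := fun d => (j + (l - d)) % l
  have hg : Set.InjOn g (Finset.range (l - r)) := by
    intro d hd e he hde
    simp only [Finset.coe_range, Set.mem_Iio] at hd he
    have h1 : (l - d) ≡ (l - e) [MOD l] := Nat.ModEq.add_left_cancel' j hde
    have h2 : d ≡ e [MOD l] := by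
      have h3 : (l - d) + (d + e) ≡ (l - e) + (d + e) [MOD l] := h1.add_right _
      have h4 : (l - d) + (d + e) = l + e := by omega
      have h5 : (l - e) + (d + e) = l + d := by omega
      rw [h4, h5] at h3
      exact (Nat.ModEq.add_left_cancel' l h3).symm
    exact h2.eq_of_lt_of_lt (by omega) (by omega)
  have hDl : (Finset.range (l - r)).image g ⊆ Finset.range l := by
    intro i hi
    obtain ⟨d, -, rfl⟩ := Finset.mem_image.1 hi
    exact Finset.mem_range.2 (Nat.mod_lt _ hl)
  obtain ⟨i, hi⟩ := Finset.inter_nonempty_of_card_lt_card_add_card hIl hDl (by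
    rw [Finset.card_image_of_injOn hg, Finset.card_range, Finset.card_range]; omega)
  obtain ⟨hiI, hiD⟩ := Finset.mem_inter.1 hi
  obtain ⟨d, hd, rfl⟩ := Finset.mem_image.1 hiD
  rw [Finset.mem_range] at hd
  have hj : shift^[j] x = shift^[d] (shift^[g d] x) := by
    rw [iterate_mod_minimalPeriod_eq, ← iterate_add_apply,
      show d + (j + (l - d)) = j + l by omega, iterate_add_apply, hldef, iterate_minimalPeriod]
  rw [hj]
  exact (pre_iterate_shift_isInfix_pre _ (by omega)).trans (hI _ hiI).2

end Words

/-- A finite connected multigraph has at most one more vertex than edges; connectedness is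
expressed by saying that edge-invariant predicates are constant on the vertices. -/
lemma ncard_le_ncard_add_one_of_connected {V E : Type*} {A : Set V} {T : Set E}
    (hA : A.Finite) (hT : T.Finite) (s t : E → V) (hs : ∀ e ∈ T, s e ∈ A) (ht : ∀ e ∈ T, t e ∈ A)
    (hne : A.Nonempty)
    (h : ∀ f : V → Prop, (∀ e ∈ T, f (s e) ↔ f (t e)) → ∀ u ∈ A, ∀ v ∈ A, f u → f v) :
    A.ncard ≤ T.ncard + 1 := by
  classical
  have := hA.to_subtype
  have := hT.to_subtype
  have := hne.to_subtype
  let G : SimpleGraph A :=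
    SimpleGraph.fromRel fun u v => ∃ e ∈ T, s e = u ∧ t e = v
  have hadj : ∀ e (he : e ∈ T), G.Reachable ⟨s e, hs e he⟩ ⟨t e, ht e he⟩ := by
    intro e he
    by_cases heq : s e = t e
    · simp only [heq]; rfl
    · refine SimpleGraph.Adj.reachable ?_
      rw [SimpleGraph.fromRel_adj]
      exact ⟨fun h => heq (congrArg Subtype.val h), Or.inl ⟨e, he, rfl, rfl⟩⟩
  have hconn : G.Connected := by
    refine ⟨fun u v => ?_⟩
    have := h (fun z => ∃ hz : z ∈ A, G.Reachable u ⟨z, hz⟩) ?_ u u.2 v v.2 ⟨u.2, by rfl⟩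
    · exact this.2
    · intro e he
      exact ⟨fun ⟨_, h1⟩ => ⟨ht e he, h1.trans (hadj e he)⟩,
        fun ⟨_, h1⟩ => ⟨hs e he, h1.trans (hadj e he).symm⟩⟩
  have hcard := hconn.card_vert_le_card_edgeSet_add_one
  have hedge : Nat.card G.edgeSet ≤ Nat.card T := by
    have hex : ∀ z : G.edgeSet, ∃ e : T, z.1 = s(⟨s e, hs e e.2⟩, ⟨t e, ht e e.2⟩) := by
      rintro ⟨z, hz⟩
      induction z with | _ u v
      rw [SimpleGraph.mem_edgeSet, SimpleGraph.fromRel_adj] at hz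
      rcases hz.2 with ⟨e, he, h1, h2⟩ | ⟨e, he, h1, h2⟩
      · exact ⟨⟨e, he⟩, by simp [h1, h2]⟩
      · exact ⟨⟨e, he⟩, by simp [h1, h2, Sym2.eq_swap]⟩
    choose g hg using hex
    refine Nat.card_le_card_of_injective g fun a b hab => Subtype.ext ?_
    rw [hg a, hg b, hab]
  exact hcard.trans (Nat.add_le_add_right hedge 1)

section Lyndon

variable {α : Type*} [LinearOrder α]

lemma shift_iterate_le_of_agree {x y : ℕ → α} {b : ℕ} (hxy : toLex x ≤ toLex y)
    (h : ∀ j < b, x j = y j) : toLex (shift^[b] x) ≤ toLex (shift^[b] y) := by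
  rcases hxy.eq_or_lt with heq | ⟨i, hi, hlt⟩
  · rw [toLex.injective heq]
  · have hbi : b ≤ i := by
      by_contra! hib
      exact hlt.ne (h i hib)
    refine le_of_lt ⟨i - b, fun j hj => ?_, ?_⟩
    · simpa [shift_iterate_apply] using hi (j + b) (by omega)
    · simpa [shift_iterate_apply, Nat.sub_add_cancel hbi] using hlt

lemma IsLyndon.minimalPeriod_pos {x : ℕ → α} (hx : IsLyndon x) : 0 < minimalPeriod shift x :=
  minimalPeriod_pos_of_mem_periodicPts hx.1

/-- The root of a Lyndon word has no proper border. -/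
lemma IsLyndon.unbordered {x : ℕ → α} (hx : IsLyndon x) {q : ℕ} (hq : 0 < q)
    (hql : q < minimalPeriod shift x) :
    ¬ ∀ j, j + q < minimalPeriod shift x → x (j + q) = x j := by
  intro h
  set l := minimalPeriod shift x with hl
  have h1 : toLex (shift^[l - q] x) ≤ toLex (shift^[l - q] (shift^[q] x)) := by
    refine shift_iterate_le_of_agree (hx.2 q) fun j hj => ?_
    rw [shift_iterate_apply, h j (by omega)]
  rw [← iterate_add_apply, Nat.sub_add_cancel hql.le, hl, iterate_minimalPeriod, ← hl] at h1
  have h2 : IsPeriodicPt shift (l - q) x := toLex.injective (h1.antisymm (hx.2 _))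
  have := h2.minimalPeriod_le (by omega)
  omega

lemma IsLyndon.eq_of_orbit {x y : ℕ → α} (hx : IsLyndon x) (hy : IsLyndon y) {i : ℕ}
    (h : x = shift^[i] y) : x = y := by
  have hpos := hy.minimalPeriod_pos
  apply toLex.injective
  refine le_antisymm ?_ (h ▸ hy.2 i)
  have h1 : shift^[i * minimalPeriod shift y - i] x = y := by
    rw [h, ← iterate_add_apply, Nat.sub_add_cancel (Nat.le_mul_of_pos_right _ hpos)]
    exact (isPeriodicPt_minimalPeriod shift y).const_mul i
  have h2 := hx.2 (i * minimalPeriod shift y - i)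
  rwa [h1] at h2

/-- The distinguished edge of a small circuit does not lie on another circuit that is not
longer. -/
lemma IsLyndon.eq_of_pre_eq {x y : ℕ → α} (hx : IsLyndon x) (hy : IsLyndon y) {n i : ℕ}
    (hn : minimalPeriod shift x ≤ n)
    (hyx : minimalPeriod shift y ≤ minimalPeriod shift x)
    (h : pre x (n + 1) = pre (shift^[i] y) (n + 1)) : x = shift^[i] y := by
  rw [pre_eq_iff] at h
  have hper : IsPeriodicPt shift (minimalPeriod shift y) (shift^[i] y) :=
    (isPeriodicPt_minimalPeriod shift y).apply_iterate i
  have heq : minimalPeriod shift y = minimalPeriod shift x := by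
    refine hyx.eq_of_not_lt fun hlt => hx.unbordered hy.minimalPeriod_pos hlt fun j hj => ?_
    rw [h _ (by omega), h j (by omega), apply_add_of_isPeriodicPt hper]
  rw [heq] at hper
  funext j
  have hlt := Nat.mod_lt j hx.minimalPeriod_pos
  rw [← apply_mod_of_isPeriodicPt (isPeriodicPt_minimalPeriod shift x) j,
    ← apply_mod_of_isPeriodicPt hper j, h _ (by omega)]

lemma injOn_pre_circuits (w : List α) (n : ℕ) :
    Set.InjOn (fun x => pre x (n + 1)) (circuits w n) := by
  intro x hx y hy h
  rcases le_total (minimalPeriod shift x) (minimalPeriod shift y) with hle | hle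
  · exact (hy.1.eq_of_pre_eq (i := 0) hx.1 hy.2.1 hle h.symm).symm
  · exact hx.1.eq_of_pre_eq (i := 0) hy.1 hx.2.1 hle h

lemma pre_image_circuits_subset (w : List α) (n : ℕ) :
    (fun x => pre x (n + 1)) '' circuits w n ⊆ factors w (n + 1) := by
  rintro _ ⟨x, hx, rfl⟩
  exact ⟨hx.2.2 0, length_pre _ _⟩

lemma finite_circuits (w : List α) (n : ℕ) : (circuits w n).Finite :=
  Set.Finite.of_finite_image ((finite_factors_s4 w (n + 1)).subset (pre_image_circuits_subset w n))
    (injOn_pre_circuits w n)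

/-- An invariant of the edges that are not distinguished is an invariant of all edges. -/
lemma invariant_of_circuits {w : List α} {n : ℕ} {f : List α → Prop}
    (hf : ∀ e ∈ factors w (n + 1) \ (fun x => pre x (n + 1)) '' circuits w n,
      f e.dropLast ↔ f e.tail) :
    ∀ e ∈ factors w (n + 1), f e.dropLast ↔ f e.tail := by
  have key : ∀ d, ∀ x ∈ circuits w n, minimalPeriod shift x = d →
      (f (pre x (n + 1)).dropLast ↔ f (pre x (n + 1)).tail) := by
    intro d
    induction d using Nat.strong_induction_on with
    | _ d ih =>
      intro x hx hd
      have hpos := hx.1.minimalPeriod_pos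
      have step : ∀ i, 0 < i → i < d →
          (f (pre (shift^[i] x) n) ↔ f (pre (shift^[i + 1] x) n)) := by
        intro i hi hid
        have he : f (pre (shift^[i] x) (n + 1)).dropLast ↔
            f (pre (shift^[i] x) (n + 1)).tail := by
          by_cases hmem : pre (shift^[i] x) (n + 1) ∈ (fun x => pre x (n + 1)) '' circuits w n
          · obtain ⟨y, hy, hyx⟩ := hmem
            rw [← hyx]
            refine ih _ ?_ y hy rfl
            by_contra! hle
            have h1 := hy.1.eq_of_pre_eq hx.1 hy.2.1 (hd.trans_le hle) hyx
            have h2 : IsPeriodicPt shift i x := (h1.symm.trans (hy.1.eq_of_orbit hx.1 h1))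
            have := h2.minimalPeriod_le hi
            omega
          · exact hf _ ⟨⟨hx.2.2 i, length_pre _ _⟩, hmem⟩
        rwa [dropLast_pre, tail_pre, ← iterate_succ_apply' shift] at he
      have chain : ∀ i, i < d → (f (pre (shift x) n) ↔ f (pre (shift^[i + 1] x) n)) := by
        intro i
        induction i with
        | zero => intro _; rfl
        | succ i ihi =>
          intro hi
          exact (ihi (by omega)).trans (step (i + 1) (by omega) hi)
      have hlast := chain (d - 1) (by omega)
      rw [Nat.sub_add_cancel (by omega), ← hd, iterate_minimalPeriod] at hlast
      rw [dropLast_pre, tail_pre]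
      exact hlast.symm
  intro e he
  by_cases hmem : e ∈ (fun x => pre x (n + 1)) '' circuits w n
  · obtain ⟨x, hx, rfl⟩ := hmem
    exact key _ x hx rfl
  · exact hf e ⟨he, hmem⟩

/-- The number of small circuits is at most the cyclomatic number of the Rauzy graph. -/
lemma ncard_circuits_add_ncard_factors_le {w : List α} {n : ℕ} (hn : n < w.length) :
    (circuits w n).ncard + (factors w n).ncard ≤ (factors w (n + 1)).ncard + 1 := by
  have hfin := finite_factors_s4 w (n + 1)
  have hsub := pre_image_circuits_subset w n
  have hcard := Set.ncard_sdiff_add_ncard_of_subset hsub hfin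
  rw [(injOn_pre_circuits w n).ncard_image] at hcard
  have hmain := ncard_le_ncard_add_one_of_connected (finite_factors_s4 w n)
    (hfin.subset (Set.sdiff_subset (t := (fun x => pre x (n + 1)) '' circuits w n)))
    List.dropLast List.tail
    (fun e he => ⟨(List.dropLast_prefix e).isInfix.trans he.1.1, by simp [he.1.2]⟩)
    (fun e he => ⟨(List.tail_suffix e).isInfix.trans he.1.1, by simp [he.1.2]⟩)
    ⟨_, drop_take_mem_factors (i := 0) (by omega)⟩ ?_
  · omega
  · intro f hf
    have hinv := invariant_of_circuits hf
    have hpath : ∀ i, i + n ≤ w.length → (f ((w.drop 0).take n) ↔ f ((w.drop i).take n)) := by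
      intro i
      induction i with
      | zero => intro _; rfl
      | succ i ih =>
        intro hi
        have h := hinv _ (drop_take_mem_factors (w := w) (i := i) (n := n + 1) (by omega))
        have h1 : ((w.drop i).take (n + 1)).dropLast = (w.drop i).take n := by
          rw [List.dropLast_eq_take, List.take_take]
          congr 1
          simp; omega
        have h2 : ((w.drop i).take (n + 1)).tail = (w.drop (i + 1)).take n := by
          rw [← List.drop_one, List.drop_take, List.drop_drop]
          simp
        rw [h1, h2] at h
        exact (ih (by omega)).trans h
    intro u hu v hv
    obtain ⟨i, hi, rfl⟩ := exists_drop_take_of_mem_factors hu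
    obtain ⟨j, hj, rfl⟩ := exists_drop_take_of_mem_factors hv
    exact ((hpath i hi).symm.trans (hpath j hj)).1

lemma sum_ncard_circuits_le (w : List α) :
    ∑ n ∈ Finset.range w.length, (circuits w n).ncard ≤ w.length := by
  have h : ∀ k ≤ w.length,
      ∑ n ∈ Finset.range k, (circuits w n).ncard + 1 ≤ (factors w k).ncard + k := by
    intro k
    induction k with
    | zero =>
      intro _
      have : factors w 0 = {[]} := by
        ext v
        simp only [factors, Set.mem_ofPred_eq, List.length_eq_zero_iff, Set.mem_singleton_iff]
        exact ⟨fun h => h.2, fun h => ⟨h ▸ List.nil_infix, h⟩⟩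
      simp [this]
    | succ k ih =>
      intro hk
      have h1 := ih (by omega)
      have h2 := ncard_circuits_add_ncard_factors_le (w := w) (n := k) hk
      rw [Finset.sum_range_succ]
      omega
  have h1 := h w.length le_rfl
  have h2 : factors w w.length = {w} := by
    ext v
    simp only [factors, Set.mem_ofPred_eq, Set.mem_singleton_iff]
    exact ⟨fun h => h.1.eq_of_length h.2, fun h => by simp [h]⟩
  rw [h2, Set.ncard_singleton] at h1
  omega

/-- Every periodic infinite word is a shift of a Lyndon word. -/
lemma exists_isLyndon {y : ℕ → α} {h : ℕ} (hh : 0 < h) (hy : IsPeriodicPt shift h y) :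
    ∃ x i, IsLyndon x ∧ i < minimalPeriod shift x ∧ minimalPeriod shift x ∣ h ∧
      y = shift^[i] x := by
  obtain ⟨a, ha, hmin⟩ := Finset.exists_min_image (Finset.range h)
    (fun i => toLex (shift^[i] y)) ⟨0, by simpa using hh⟩
  have hah : a < h := by simpa using ha
  have hper : IsPeriodicPt shift h (shift^[a] y) := hy.apply_iterate a
  have hLyn : IsLyndon (shift^[a] y) := by
    refine ⟨mk_mem_periodicPts hh hper, fun i => ?_⟩
    rw [← iterate_add_apply, ← hy.iterate_mod_apply (i + a)]
    exact hmin _ (by simpa using Nat.mod_lt _ hh)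
  refine ⟨shift^[a] y, (h - a) % minimalPeriod shift (shift^[a] y), hLyn,
    Nat.mod_lt _ hLyn.minimalPeriod_pos, hper.minimalPeriod_dvd, ?_⟩
  rw [iterate_mod_minimalPeriod_eq, ← iterate_add_apply, Nat.sub_add_cancel hah.le, hy.eq]

lemma exists_isLyndon_of_square {u : List α} (hu : u ≠ []) :
    ∃ x i k, IsLyndon x ∧ i < minimalPeriod shift x ∧ 0 < k ∧
      u ++ u = pre (shift^[i] x) (2 * (minimalPeriod shift x * k)) := by
  have hh : 0 < u.length := List.length_pos_iff.2 hu
  let y : ℕ → α := fun j => u[j % u.length]'(Nat.mod_lt _ hh)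
  have hy : IsPeriodicPt shift u.length y := by
    funext j
    rw [shift_iterate_apply]
    simp [y]
  obtain ⟨x, i, hx, hi, ⟨k, hk⟩, hyx⟩ := exists_isLyndon hh hy
  refine ⟨x, i, k, hx, hi, Nat.pos_of_ne_zero fun h0 => by simp [h0] at hk; simp [hk] at hu, ?_⟩
  rw [← hk, ← hyx]
  apply List.ext_getElem
  · simp; omega
  · intro j h1 h2
    simp only [List.length_append] at h1
    simp only [pre, List.getElem_map, List.getElem_range, y, List.getElem_append]
    split_ifs with hj
    · simp [Nat.mod_eq_of_lt hj]
    · simp [Nat.mod_eq_sub_mod (not_lt.1 hj),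
        Nat.mod_eq_of_lt (show j - u.length < u.length by omega)]

lemma ncard_squares_le_sum (w : List α) :
    numSquares w ≤ ∑ n ∈ Finset.range w.length, (circuits w n).ncard := by
  classical
  let P : Finset (Σ _ : ℕ, ℕ → α) :=
    (Finset.range w.length).sigma fun n => (finite_circuits w n).toFinset
  have hP : P.card = ∑ n ∈ Finset.range w.length, (circuits w n).ncard := by
    simp only [P, Finset.card_sigma, Set.ncard_eq_toFinset_card _ (finite_circuits w _)]
  let p : (ℕ → α) → ℕ → ℕ → Prop := fun x h i =>
    i < minimalPeriod shift x ∧ pre (shift^[i] x) (2 * h) <:+: w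
  let hgt : ℕ → (ℕ → α) → ℕ := fun n x =>
    minimalPeriod shift x * ((n + minimalPeriod shift x) / minimalPeriod shift x / 2)
  let g : (Σ _ : ℕ, ℕ → α) → List α := fun z =>
    pre (shift^[Nat.nth (p z.2 (hgt z.1 z.2)) (z.1 + minimalPeriod shift z.2 - 2 * hgt z.1 z.2)]
      z.2) (2 * hgt z.1 z.2)
  rw [← hP, ← Set.ncard_coe_finset]
  refine (Set.ncard_le_ncard ?_ (P.finite_toSet.image g)).trans
    (Set.ncard_image_le P.finite_toSet)
  rintro _ ⟨hw, u, hu, rfl⟩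
  obtain ⟨x, i, k, hx, hi, hk, huu⟩ := exists_isLyndon_of_square hu
  rw [huu] at hw ⊢
  have hl := hx.minimalPeriod_pos
  set l := minimalPeriod shift x with hldef
  have hlk : l ≤ l * k := Nat.le_mul_of_pos_right _ hk
  have hpi : p x (l * k) i := ⟨hi, hw⟩
  set r := Nat.count (p x (l * k)) i with hr
  have hri : r < ((Finset.range l).filter (p x (l * k))).card := by
    rw [← Nat.count_eq_card_filter_range]
    exact Nat.count_strict_mono hpi hi
  have hrl : r < l := hri.trans_le (by simpa using Finset.card_filter_le (Finset.range l) _)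
  have hmem : x ∈ circuits w (2 * (l * k) - l + r) := by
    refine ⟨hx, by omega, fun j => pre_infix_of_lt_card hl hlk (fun i hi => ?_) hri j⟩
    exact (Finset.mem_filter.1 hi).2
  have hlen := (hmem.2.2 0).length_le
  rw [length_pre] at hlen
  have hgt_eq : hgt (2 * (l * k) - l + r) x = l * k := by
    have h1 : 2 * (l * k) - l + r + l = r + l * (2 * k) := by
      have : l * (2 * k) = 2 * (l * k) := by ring
      omega
    simp only [hgt, ← hldef, h1, Nat.add_mul_div_left _ _ hl, Nat.div_eq_of_lt hrl]
    simp
  refine ⟨⟨2 * (l * k) - l + r, x⟩, ?_, ?_⟩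
  · simp only [P, Finset.mem_coe, Finset.mem_sigma, Finset.mem_range, Set.Finite.mem_toFinset]
    exact ⟨by omega, hmem⟩
  · simp only [g, hgt_eq, ← hldef]
    rw [show 2 * (l * k) - l + r + l - 2 * (l * k) = r by omega, hr, Nat.nth_count hpi]

end Lyndon

theorem fraenkel_simpson {α : Type*} (w : List α) :
    numSquares w ≤ w.length := by
  obtain ⟨_, -⟩ := exists_wellFoundedLT α
  exact (ncard_squares_le_sum w).trans (sum_ncard_circuits_le w)
end
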